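/- arXiv:2408.07039 — 15 statements merged into one kernel-verified Lean document; each statement's English description precedes it below -/
import Mathlib

section
/- Let X be a compact Hausdorff topological space and d a separated metric on X. Then the topology of X coincides with the topology symmetrically induced by d if and only if the function (x, y) ↦ d x y is upper semicontinuous on X × X (equivalently, continuous with respect to the lower topology on [0,∞]). -/
open ENNReal

/-- `d` is a (Lawvere-style) metric: `d x x = 0` and the triangle inequality holds. -/
def IsEMetric {X : Type*} (d : X → X → ℝ≥0∞) : Prop :=
  (∀ x, d x x = 0) ∧ ∀ x y z, d x z ≤ d x y + d y z

/-- `d` is separated: `d x y = 0` and `d y x = 0` imply `x = y`. -/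
def IsSepMetric {X : Type*} (d : X → X → ℝ≥0∞) : Prop :=
  ∀ x y, d x y = 0 → d y x = 0 → x = y

/-- The topology symmetrically induced by `d`, generated by the right and left open balls. -/
def symTopology {X : Type*} (d : X → X → ℝ≥0∞) : TopologicalSpace X :=
  TopologicalSpace.generateFrom
    {s | ∃ x₀ u, s = {x | d x₀ x < u} ∨ s = {x | d x x₀ < u}}

open Topology Filter

/-- A compact topology finer than a Hausdorff topology equals it. -/
theorem TopologicalSpace.eq_of_le_of_compactSpace_of_t2Space {X : Type*}
    {t s : TopologicalSpace X} (h : t ≤ s) (ht : @CompactSpace X t) (hs : @T2Space X s) :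
    t = s := by
  have hc : @IsClosedMap X X t s id :=
    @Continuous.isClosedMap X X t s ht hs id (continuous_id_of_le h)
  refine TopologicalSpace.ext_isClosed fun A => ⟨fun hA => ?_, fun hA => hA.mono h⟩
  simpa using hc A hA

theorem isOpen_symTopology_right_ball {X : Type*} (d : X → X → ℝ≥0∞) (x₀ : X) (u : ℝ≥0∞) :
    IsOpen[symTopology d] {x | d x₀ x < u} :=
  TopologicalSpace.isOpen_generateFrom_of_mem ⟨x₀, u, Or.inl rfl⟩

theorem isOpen_symTopology_left_ball {X : Type*} (d : X → X → ℝ≥0∞) (x₀ : X) (u : ℝ≥0∞) :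
    IsOpen[symTopology d] {x | d x x₀ < u} :=
  TopologicalSpace.isOpen_generateFrom_of_mem ⟨x₀, u, Or.inr rfl⟩

theorem exists_disjoint_isOpen_symTopology {X : Type*} {d : X → X → ℝ≥0∞} (hmet : IsEMetric d)
    {x y : X} (hxy : d x y ≠ 0) :
    ∃ U V : Set X, IsOpen[symTopology d] U ∧ IsOpen[symTopology d] V ∧
      x ∈ U ∧ y ∈ V ∧ Disjoint U V := by
  have hpos : 0 < d x y / 2 := ENNReal.half_pos hxy
  refine ⟨_, _, isOpen_symTopology_right_ball d x (d x y / 2),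
    isOpen_symTopology_left_ball d y (d x y / 2), ?_, ?_, ?_⟩
  · simpa [hmet.1] using hxy
  · simpa [hmet.1] using hxy
  · refine Set.disjoint_left.2 fun z (hz : d x z < _) (hz' : d z y < _) => ?_
    refine (hmet.2 x z y).not_gt ?_
    calc d x z + d z y < d x y / 2 + d x y / 2 := ENNReal.add_lt_add hz hz'
      _ = d x y := ENNReal.add_halves _

theorem t2Space_symTopology {X : Type*} {d : X → X → ℝ≥0∞} (hmet : IsEMetric d)
    (hsep : IsSepMetric d) : @T2Space X (symTopology d) := by
  refine @T2Space.mk X (symTopology d) fun x y hne => ?_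
  by_cases hxy : d x y = 0
  · have hyx : d y x ≠ 0 := fun h => hne (hsep x y hxy h)
    obtain ⟨U, V, hU, hV, hy, hx, hd⟩ := exists_disjoint_isOpen_symTopology hmet hyx
    exact ⟨V, U, hV, hU, hx, hy, hd.symm⟩
  · exact exists_disjoint_isOpen_symTopology hmet hxy

theorem upperSemicontinuous_of_le_symTopology {X : Type*} [t : TopologicalSpace X]
    {d : X → X → ℝ≥0∞} (hmet : IsEMetric d) (h : t ≤ symTopology d) :
    UpperSemicontinuous (fun p : X × X => d p.1 p.2) := by
  rintro ⟨a, b⟩ u hu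
  obtain ⟨r, hr, hru⟩ := ENNReal.lt_iff_exists_add_pos_lt.1 hu
  have hpos : (0 : ℝ≥0∞) < r / 2 := ENNReal.half_pos (by exact_mod_cast hr.ne')
  have ha : ∀ᶠ x in 𝓝 a, d x a < r / 2 :=
    (h _ (isOpen_symTopology_left_ball d a (r / 2))).mem_nhds
      (show d a a < r / 2 by rwa [hmet.1])
  have hb : ∀ᶠ y in 𝓝 b, d b y < r / 2 :=
    (h _ (isOpen_symTopology_right_ball d b (r / 2))).mem_nhds
      (show d b b < r / 2 by rwa [hmet.1])
  filter_upwards [ha.prod_nhds hb] with ⟨x, y⟩ ⟨hx, hy⟩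
  calc d x y ≤ d x a + (d a b + d b y) :=
        (hmet.2 x a y).trans (add_le_add_right (hmet.2 a b y) _)
    _ ≤ r / 2 + (d a b + r / 2) := by gcongr
    _ = d a b + (r / 2 + r / 2) := by ring
    _ = d a b + r := by rw [ENNReal.add_halves]
    _ < u := hru

theorem le_symTopology_of_upperSemicontinuous {X : Type*} [t : TopologicalSpace X]
    {d : X → X → ℝ≥0∞} (h : UpperSemicontinuous (fun p : X × X => d p.1 p.2)) :
    t ≤ symTopology d := by
  refine le_generateFrom ?_
  rintro _ ⟨x₀, u, rfl | rfl⟩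
  · exact (h.isOpen_preimage u).preimage (Continuous.prodMk_right x₀)
  · exact (h.isOpen_preimage u).preimage (Continuous.prodMk_left x₀)

theorem stmt_0 {X : Type*} [t : TopologicalSpace X] [CompactSpace X] [T2Space X]
    (d : X → X → ℝ≥0∞) (hmet : IsEMetric d) (hsep : IsSepMetric d) :
    t = symTopology d ↔ UpperSemicontinuous (fun p : X × X => d p.1 p.2) := by
  exact ⟨fun h => upperSemicontinuous_of_le_symTopology hmet h.le,
    fun h => TopologicalSpace.eq_of_le_of_compactSpace_of_t2Space
      (le_symTopology_of_upperSemicontinuous h) ‹_› (t2Space_symTopology hmet hsep)⟩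
end

section
/- Let e : X → Y be a surjective morphism and m : A → B an embedding of separated metric compact Hausdorff spaces, and let u : X → A and v : Y → B be morphisms with m ∘ u = v ∘ e. Then there exists a unique morphism w : Y → A such that w ∘ e = u and m ∘ w = v. (This expresses that the surjective morphisms and the embeddings form an orthogonal factorisation system.) -/
open ENNReal

/-- The structure of a separated metric compact Hausdorff space on a compact Hausdorff
space: a separated metric, lower semicontinuous on the product. -/
def IsSMCHMetric {X : Type*} [TopologicalSpace X] (d : X → X → ℝ≥0∞) : Prop :=
  IsEMetric d ∧ IsSepMetric d ∧ LowerSemicontinuous (fun p : X × X => d p.1 p.2)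

theorem stmt_2 {X Y A B : Type*}
    [TopologicalSpace X] [CompactSpace X] [T2Space X]
    [TopologicalSpace Y] [CompactSpace Y] [T2Space Y]
    [TopologicalSpace A] [CompactSpace A] [T2Space A]
    [TopologicalSpace B] [CompactSpace B] [T2Space B]
    (dX : X → X → ℝ≥0∞) (dY : Y → Y → ℝ≥0∞) (dA : A → A → ℝ≥0∞) (dB : B → B → ℝ≥0∞)
    (hX : IsSMCHMetric dX) (hY : IsSMCHMetric dY) (hA : IsSMCHMetric dA) (hB : IsSMCHMetric dB)
    -- `e` is a surjective morphism
    (e : X → Y) (he : Continuous e) (hene : ∀ x x', dY (e x) (e x') ≤ dX x x')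
    (hesurj : Function.Surjective e)
    -- `m` is an embedding
    (m : A → B) (hm : Continuous m) (hminj : Function.Injective m)
    (hmiso : ∀ a a', dB (m a) (m a') = dA a a')
    -- `u`, `v` are morphisms
    (u : X → A) (hu : Continuous u) (hune : ∀ x x', dA (u x) (u x') ≤ dX x x')
    (v : Y → B) (hv : Continuous v) (hvne : ∀ y y', dB (v y) (v y') ≤ dY y y')
    (hcomm : m ∘ u = v ∘ e) :
    ∃! w : Y → A,
      (Continuous w ∧ ∀ y y', dA (w y) (w y') ≤ dY y y') ∧ w ∘ e = u ∧ m ∘ w = v := by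
  have hw (y : Y) : ∃ a, m a = v y := by
    obtain ⟨x, rfl⟩ := hesurj y
    exact ⟨u x, congrFun hcomm x⟩
  choose w hw using hw
  have hmw : m ∘ w = v := funext hw
  have hcont : Continuous w :=
    (hm.isClosedEmbedding hminj).isEmbedding.continuous_iff.2 (hmw ▸ hv)
  refine ⟨w, ⟨⟨hcont, fun y y' => ?_⟩, ?_, hmw⟩, fun w' hw' => ?_⟩
  · rw [← hmiso, hw, hw]
    exact hvne y y'
  · exact funext fun x => hminj ((hw (e x)).trans (congrFun hcomm x).symm)
  · exact funext fun y => hminj ((congrFun hw'.2.2 y).trans (hw y).symm)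
end

section
/- Let f : X → Y and g : X → Z be surjective morphisms of separated metric compact Hausdorff spaces. Then there exists a morphism h : Y → Z with h ∘ f = g if and only if d_Z (g x) (g x') ≤ d_Y (f x) (f x') for all x, x' ∈ X; moreover, such an h is unique. -/
open ENNReal

theorem stmt_3 {X Y Z : Type*}
    [TopologicalSpace X] [CompactSpace X] [T2Space X]
    [TopologicalSpace Y] [CompactSpace Y] [T2Space Y]
    [TopologicalSpace Z] [CompactSpace Z] [T2Space Z]
    (dX : X → X → ℝ≥0∞) (dY : Y → Y → ℝ≥0∞) (dZ : Z → Z → ℝ≥0∞)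
    (hX : IsSMCHMetric dX) (hY : IsSMCHMetric dY) (hZ : IsSMCHMetric dZ)
    (f : X → Y) (hf : Continuous f) (hfne : ∀ x x', dY (f x) (f x') ≤ dX x x')
    (hfsurj : Function.Surjective f)
    (g : X → Z) (hg : Continuous g) (hgne : ∀ x x', dZ (g x) (g x') ≤ dX x x')
    (hgsurj : Function.Surjective g) :
    ((∃ h : Y → Z, (Continuous h ∧ ∀ y y', dZ (h y) (h y') ≤ dY y y') ∧ h ∘ f = g) ↔
      ∀ x x', dZ (g x) (g x') ≤ dY (f x) (f x')) ∧
    ∀ h₁ h₂ : Y → Z, h₁ ∘ f = g → h₂ ∘ f = g → h₁ = h₂ := by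
  have hquot := hf.isClosedMap.isQuotientMap hf hfsurj
  refine ⟨⟨?_, fun hle => ?_⟩, fun h₁ h₂ e₁ e₂ => hfsurj.injective_comp_right (e₁.trans e₂.symm)⟩
  · rintro ⟨h, ⟨-, hne⟩, rfl⟩ x x'
    exact hne (f x) (f x')
  · have hfac : Function.FactorsThrough g f := fun x x' hxx' =>
      hZ.2.1 _ _
        (le_antisymm ((hle x x').trans_eq (by rw [hxx', hY.1.1])) zero_le)
        (le_antisymm ((hle x' x).trans_eq (by rw [hxx', hY.1.1])) zero_le)
    obtain ⟨h, rfl⟩ : ∃ h : Y → Z, h ∘ f = g :=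
      ⟨fun y => g (hfsurj y).choose, funext fun x => hfac (hfsurj (f x)).choose_spec⟩
    exact ⟨h, ⟨hquot.continuous_iff.2 hg, hfsurj.forall₂.2 hle⟩, rfl⟩
end

section
/- Let (X, d) be a separated metric compact Hausdorff space and γ a continuous submetric on X. Then the relation x ∼ y defined by (γ x y = 0 and γ y x = 0) is an equivalence relation on X; γ descends to a well-defined separated metric d̄ on the quotient X/∼ with d̄ [x] [y] = γ x y; the quotient X/∼, equipped with the quotient topology and the metric d̄, is a separated metric compact Hausdorff space (in particular the quotient topology is compact Hausdorff and d̄ is lower semicontinuous on (X/∼) × (X/∼)); and the projection X → X/∼ is a surjective morphism. -/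
open ENNReal

/-- The relation identifying points at mutual distance `0` for `γ`. -/
def simRel {X : Type*} (γ : X → X → ℝ≥0∞) : X → X → Prop :=
  fun x y => γ x y = 0 ∧ γ y x = 0

/-- On a compact space, the projection to the quotient by an equivalence relation with closed graph
is proper. -/
theorem isProperMap_quotMk_of_isClosed {X : Type*} [TopologicalSpace X] [CompactSpace X]
    {r : X → X → Prop} (hr : Equivalence r) (hcl : IsClosed {p : X × X | r p.1 p.2}) :
    IsProperMap (Quot.mk r) := by
  have hclosed : IsClosedMap (Quot.mk r) := by
    intro C hC
    rw [← isQuotientMap_quot_mk.isClosed_preimage]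
    convert isClosedMap_snd_of_compactSpace _ (hcl.inter (hC.preimage continuous_fst)) using 1
    ext y
    simp only [Set.mem_preimage, Set.mem_image, Set.mem_inter_iff, Set.mem_ofPred_eq, Prod.exists,
      exists_eq_right, hr.quot_mk_eq_iff]
    exact exists_congr fun _ => and_comm
  refine isProperMap_iff_isClosedMap_and_compact_fibers.2
    ⟨continuous_quot_mk, hclosed, fun y => ?_⟩
  obtain ⟨x, rfl⟩ := Quot.exists_rep y
  refine IsClosed.isCompact ?_
  convert hcl.preimage (Continuous.prodMk_left x) using 1
  ext z
  simp [hr.quot_mk_eq_iff]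

/-- The quotient of a compact space by an equivalence relation with closed graph is Hausdorff. -/
theorem t2Space_quot_of_isClosed {X : Type*} [TopologicalSpace X] [CompactSpace X]
    {r : X → X → Prop} (hr : Equivalence r) (hcl : IsClosed {p : X × X | r p.1 p.2}) :
    T2Space (Quot r) := by
  have hq := isProperMap_quotMk_of_isClosed hr hcl
  rw [t2_iff_isClosed_diagonal]
  convert (hq.prodMap hq).isClosedMap _ hcl using 1
  ext ⟨a, b⟩
  obtain ⟨x, rfl⟩ := Quot.exists_rep a
  obtain ⟨y, rfl⟩ := Quot.exists_rep b
  constructor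
  · intro h
    exact ⟨(x, y), (hr.quot_mk_eq_iff x y).1 h, rfl⟩
  · rintro ⟨⟨u, v⟩, huv, h⟩
    rw [← h]
    exact Quot.sound huv

/-- Lower semicontinuity descends along a surjective closed map. -/
theorem LowerSemicontinuous.of_comp_isClosedMap {X Y γ : Type*} [TopologicalSpace X]
    [TopologicalSpace Y] [LinearOrder γ] {q : X → Y} {f : Y → γ} (hq : IsClosedMap q)
    (hsurj : Function.Surjective q) (hf : LowerSemicontinuous (f ∘ q)) :
    LowerSemicontinuous f := by
  rw [lowerSemicontinuous_iff_isClosed_preimage] at hf ⊢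
  intro c
  rw [← Set.image_preimage_eq (f ⁻¹' Set.Iic c) hsurj]
  exact hq _ (hf c)

theorem IsEMetric.equivalence_simRel {X : Type*} {γ : X → X → ℝ≥0∞} (h : IsEMetric γ) :
    Equivalence (simRel γ) where
  refl x := ⟨h.1 x, h.1 x⟩
  symm hxy := ⟨hxy.2, hxy.1⟩
  trans {x y z} hxy hyz := by
    have h₁ := h.2 x y z
    have h₂ := h.2 z y x
    rw [hxy.1, hyz.1, add_zero] at h₁
    rw [hxy.2, hyz.2, add_zero] at h₂
    exact ⟨le_antisymm h₁ zero_le, le_antisymm h₂ zero_le⟩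

theorem IsEMetric.congr_right {X : Type*} {γ : X → X → ℝ≥0∞} (h : IsEMetric γ) (x : X) {y z : X}
    (hyz : simRel γ y z) : γ x y = γ x z := by
  have h₁ := h.2 x z y
  have h₂ := h.2 x y z
  rw [hyz.2, add_zero] at h₁
  rw [hyz.1, add_zero] at h₂
  exact le_antisymm h₁ h₂

theorem IsEMetric.congr_left {X : Type*} {γ : X → X → ℝ≥0∞} (h : IsEMetric γ) {x y : X} (z : X)
    (hxy : simRel γ x y) : γ x z = γ y z := by
  have h₁ := h.2 x y z
  have h₂ := h.2 y x z
  rw [hxy.1, zero_add] at h₁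
  rw [hxy.2, zero_add] at h₂
  exact le_antisymm h₁ h₂

theorem isClosed_simRel {X : Type*} [TopologicalSpace X] {γ : X → X → ℝ≥0∞}
    (h : LowerSemicontinuous (fun p : X × X => γ p.1 p.2)) :
    IsClosed {p : X × X | simRel γ p.1 p.2} := by
  have h0 : IsClosed {p : X × X | γ p.1 p.2 = 0} := by
    convert h.isClosed_preimage 0 using 1
    ext p
    simp
  exact h0.inter (h0.preimage continuous_swap)

theorem stmt_4 {X : Type*} [TopologicalSpace X] [CompactSpace X] [T2Space X]
    (d : X → X → ℝ≥0∞) (hmet : IsEMetric d) (hsep : IsSepMetric d)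
    (hlsc : LowerSemicontinuous (fun p : X × X => d p.1 p.2))
    -- `γ` is a continuous submetric on `X`
    (γ : X → X → ℝ≥0∞) (hγmet : IsEMetric γ)
    (hγlsc : LowerSemicontinuous (fun p : X × X => γ p.1 p.2))
    (hγle : ∀ x y, γ x y ≤ d x y) :
    Equivalence (simRel γ) ∧
    ∃ dbar : Quot (simRel γ) → Quot (simRel γ) → ℝ≥0∞,
      (∀ x y, dbar (Quot.mk (simRel γ) x) (Quot.mk (simRel γ) y) = γ x y) ∧
      IsEMetric dbar ∧ IsSepMetric dbar ∧
      LowerSemicontinuous (fun p : Quot (simRel γ) × Quot (simRel γ) => dbar p.1 p.2) ∧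
      CompactSpace (Quot (simRel γ)) ∧ T2Space (Quot (simRel γ)) ∧
      Continuous (Quot.mk (simRel γ)) ∧
      (∀ x y, dbar (Quot.mk (simRel γ) x) (Quot.mk (simRel γ) y) ≤ d x y) ∧
      Function.Surjective (Quot.mk (simRel γ)) := by
  have heq := hγmet.equivalence_simRel
  have hcl := isClosed_simRel hγlsc
  have hq := isProperMap_quotMk_of_isClosed heq hcl
  refine ⟨heq, Quot.lift₂ γ (fun x _ _ => hγmet.congr_right x) (fun _ _ z => hγmet.congr_left z),
    fun _ _ => rfl, ⟨?_, ?_⟩, ?_, ?_, inferInstance, t2Space_quot_of_isClosed heq hcl,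
    continuous_quot_mk, hγle, Quot.mk_surjective⟩
  · rintro ⟨x⟩
    exact hγmet.1 x
  · rintro ⟨x⟩ ⟨y⟩ ⟨z⟩
    exact hγmet.2 x y z
  · rintro ⟨x⟩ ⟨y⟩ hxy hyx
    exact Quot.sound ⟨hxy, hyx⟩
  · exact .of_comp_isClosedMap (hq.prodMap hq).isClosedMap
      (Quot.mk_surjective.prodMap Quot.mk_surjective) hγlsc
end

section
/- Let A, X, B be separated metric compact Hausdorff spaces, i : A → X an embedding and f : A → B a morphism. Define γ : (B ⊕ X) → (B ⊕ X) → [0,∞] by: γ (inl b) (inl b') = d_B b b'; γ (inr x) (inr x') = min( d_X x x' , ⨅_{a, a' ∈ A} ( d_X x (i a) + d_B (f a) (f a') + d_X (i a') x' ) ); γ (inl b) (inr x) = ⨅_{a ∈ A} ( d_B b (f a) + d_X (i a) x ); γ (inr x) (inl b) = ⨅_{a ∈ A} ( d_X x (i a) + d_B (f a) b ). Then γ is a metric on B ⊕ X (that is, γ z z = 0 for all z and γ satisfies the triangle inequality), and γ is pointwise below the coproduct metric of B ⊕ X. -/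
open ENNReal

/-- The coproduct metric on a sum: the given distances within each summand,
and `∞` between the summands. -/
noncomputable def sumMetric {X Y : Type*} (dX : X → X → ℝ≥0∞) (dY : Y → Y → ℝ≥0∞) :
    X ⊕ Y → X ⊕ Y → ℝ≥0∞
  | Sum.inl a, Sum.inl b => dX a b
  | Sum.inr a, Sum.inr b => dY a b
  | _, _ => ∞

/-- The submetric on `B ⊕ X` describing the pushout of the embedding `i : A → X`
along the morphism `f : A → B`. -/
noncomputable def gammaPush {A X B : Type*} (dX : X → X → ℝ≥0∞) (dB : B → B → ℝ≥0∞)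
    (i : A → X) (f : A → B) : B ⊕ X → B ⊕ X → ℝ≥0∞
  | Sum.inl b, Sum.inl b' => dB b b'
  | Sum.inl b, Sum.inr x => ⨅ a : A, (dB b (f a) + dX (i a) x)
  | Sum.inr x, Sum.inl b => ⨅ a : A, (dX x (i a) + dB (f a) b)
  | Sum.inr x, Sum.inr x' =>
      min (dX x x') (⨅ a : A, ⨅ a' : A, (dX x (i a) + dB (f a) (f a') + dX (i a') x'))

/-- A detour through a point of `X` does not shorten distances in `B`. -/
theorem dist_le_detour {A X B : Type*} {dX : X → X → ℝ≥0∞} {dB : B → B → ℝ≥0∞}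
    {i : A → X} {f : A → B} (hX : IsEMetric dX) (hB : IsEMetric dB)
    (hfi : ∀ a a', dB (f a) (f a') ≤ dX (i a) (i a')) (b b' : B) (a a' : A) (x : X) :
    dB b b' ≤ dB b (f a) + (dX (i a) x + dX x (i a')) + dB (f a') b' :=
  calc dB b b' ≤ dB b (f a') + dB (f a') b' := hB.2 _ _ _
    _ ≤ dB b (f a) + dB (f a) (f a') + dB (f a') b' := by gcongr; exact hB.2 _ _ _
    _ ≤ _ := by gcongr; exact (hfi a a').trans (hX.2 _ _ _)

theorem isEMetric_gammaPush {A X B : Type*} {dX : X → X → ℝ≥0∞} {dB : B → B → ℝ≥0∞}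
    {i : A → X} {f : A → B} (hX : IsEMetric dX) (hB : IsEMetric dB)
    (hfi : ∀ a a', dB (f a) (f a') ≤ dX (i a) (i a')) :
    IsEMetric (gammaPush dX dB i f) := by
  have detour := dist_le_detour hX hB hfi
  refine ⟨?_, ?_⟩
  · rintro (b | x)
    · exact hB.1 b
    · simp [gammaPush, hX.1]
  rintro (x | x) (y | y) (z | z) <;>
    simp only [gammaPush, ENNReal.iInf_add, ENNReal.add_iInf, ← min_add_add_right,
      ← min_add_add_left, le_iInf_iff, le_min_iff]
  · exact hB.2 x y z
  · intro a
    refine iInf_le_of_le a ?_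
    calc dB x (f a) + dX (i a) z ≤ (dB x y + dB y (f a)) + dX (i a) z := by
          gcongr; exact hB.2 _ _ _
      _ = _ := by ring
  · intro a a'
    calc dB x z ≤ dB x (f a') + (dX (i a') y + dX y (i a)) + dB (f a) z := detour _ _ _ _ _
      _ = _ := by ring
  · refine ⟨fun a => iInf_le_of_le a ?_, fun a₁ a₂ a => iInf_le_of_le a₂ ?_⟩
    · rw [add_assoc]
      gcongr
      exact hX.2 _ _ _
    · calc dB x (f a₂) + dX (i a₂) z
          ≤ dB x (f a) + (dX (i a) y + dX y (i a₁)) + dB (f a₁) (f a₂) + dX (i a₂) z := by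
            gcongr; exact detour _ _ _ _ _
        _ = _ := by ring
  · intro a
    refine iInf_le_of_le a ?_
    rw [add_assoc]
    gcongr
    exact hB.2 _ _ _
  · intro a' a
    refine min_le_of_right_le (iInf₂_le_of_le a a' ?_)
    calc dX x (i a) + dB (f a) (f a') + dX (i a') z
        ≤ dX x (i a) + (dB (f a) y + dB y (f a')) + dX (i a') z := by
          gcongr; exact hB.2 _ _ _
      _ = _ := by ring
  · refine ⟨fun a => iInf_le_of_le a ?_, fun a a₁ a₂ => iInf_le_of_le a₁ ?_⟩
    · rw [← add_assoc]
      gcongr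
      exact hX.2 _ _ _
    · calc dX x (i a₁) + dB (f a₁) z
          ≤ dX x (i a₁) + (dB (f a₁) (f a₂) + (dX (i a₂) y + dX y (i a)) + dB (f a) z) := by
            gcongr; exact detour _ _ _ _ _
        _ = _ := by ring
  · refine ⟨⟨min_le_of_left_le (hX.2 _ _ _),
        fun a a' => min_le_of_right_le (iInf₂_le_of_le a a' ?_)⟩,
      fun a a' => min_le_of_right_le (iInf₂_le_of_le a a' ?_),
      fun a₃ a₄ a₁ a₂ => min_le_of_right_le (iInf₂_le_of_le a₁ a₄ ?_)⟩
    · rw [add_assoc _ (dX (i a') y)]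
      gcongr
      exact hX.2 _ _ _
    · rw [← add_assoc, ← add_assoc]
      gcongr
      exact hX.2 _ _ _
    · calc dX x (i a₁) + dB (f a₁) (f a₄) + dX (i a₄) z
          ≤ dX x (i a₁) + (dB (f a₁) (f a₂) + (dX (i a₂) y + dX y (i a₃)) + dB (f a₃) (f a₄))
              + dX (i a₄) z := by
            gcongr; exact detour _ _ _ _ _
        _ = _ := by ring

theorem stmt_5 {A X B : Type*}
    [TopologicalSpace A] [CompactSpace A] [T2Space A]
    [TopologicalSpace X] [CompactSpace X] [T2Space X]
    [TopologicalSpace B] [CompactSpace B] [T2Space B]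
    (dA : A → A → ℝ≥0∞) (dX : X → X → ℝ≥0∞) (dB : B → B → ℝ≥0∞)
    (hA : IsEMetric dA ∧ IsSepMetric dA ∧ LowerSemicontinuous (fun p : A × A => dA p.1 p.2))
    (hX : IsEMetric dX ∧ IsSepMetric dX ∧ LowerSemicontinuous (fun p : X × X => dX p.1 p.2))
    (hB : IsEMetric dB ∧ IsSepMetric dB ∧ LowerSemicontinuous (fun p : B × B => dB p.1 p.2))
    -- `i` is an embedding
    (i : A → X) (hi : Continuous i) (hiinj : Function.Injective i)
    (hiiso : ∀ a a', dX (i a) (i a') = dA a a')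
    -- `f` is a morphism
    (f : A → B) (hf : Continuous f) (hfne : ∀ a a', dB (f a) (f a') ≤ dA a a') :
    IsEMetric (gammaPush dX dB i f) ∧
    ∀ w z, gammaPush dX dB i f w z ≤ sumMetric dB dX w z := by
  refine ⟨isEMetric_gammaPush hX.1 hB.1 fun a a' => (hfne a a').trans (hiiso a a').ge, ?_⟩
  rintro (b | x) (b' | x') <;> simp [gammaPush, sumMetric]
end

section
/- Let A, X, B be separated metric compact Hausdorff spaces, i : A → X an embedding and f : A → B a morphism, and let γ : (B ⊕ X) → (B ⊕ X) → [0,∞] be defined by: γ (inl b) (inl b') = d_B b b'; γ (inr x) (inr x') = min( d_X x x' , ⨅_{a, a' ∈ A} ( d_X x (i a) + d_B (f a) (f a') + d_X (i a') x' ) ); γ (inl b) (inr x) = ⨅_{a ∈ A} ( d_B b (f a) + d_X (i a) x ); γ (inr x) (inl b) = ⨅_{a ∈ A} ( d_X x (i a) + d_B (f a) b ). Then the function (w, z) ↦ γ w z is lower semicontinuous on (B ⊕ X) × (B ⊕ X), where B ⊕ X carries the sum topology. -/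
open ENNReal

/-- The infimum of a lower semicontinuous function over a compact parameter space is lower
semicontinuous in the remaining variable. -/
theorem LowerSemicontinuous.iInf_of_compactSpace {Y K : Type*} [TopologicalSpace Y]
    [TopologicalSpace K] [CompactSpace K] {F : Y → K → ℝ≥0∞}
    (hF : LowerSemicontinuous fun p : Y × K => F p.1 p.2) :
    LowerSemicontinuous fun y => ⨅ k, F y k := by
  intro y c hc
  obtain ⟨m, hcm, hm⟩ := exists_between hc
  have key := (isCompact_univ (X := K)).eventually_forall_of_forall_eventually
    (x₀ := y) (P := fun y k => m < F y k)
    fun k _ => hF (y, k) m (hm.trans_le (iInf_le _ k))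
  filter_upwards [key] with z hz
  exact hcm.trans_le (le_iInf fun k => (hz k trivial).le)

/-- A function on `(X ⊕ Y) × (X ⊕ Y)` is lower semicontinuous as soon as its restrictions to the
four summands are. -/
theorem LowerSemicontinuous.of_sum_prod_sum {X Y : Type*} [TopologicalSpace X]
    [TopologicalSpace Y] {g : X ⊕ Y → X ⊕ Y → ℝ≥0∞}
    (hll : LowerSemicontinuous fun p : X × X => g (.inl p.1) (.inl p.2))
    (hlr : LowerSemicontinuous fun p : X × Y => g (.inl p.1) (.inr p.2))
    (hrl : LowerSemicontinuous fun p : Y × X => g (.inr p.1) (.inl p.2))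
    (hrr : LowerSemicontinuous fun p : Y × Y => g (.inr p.1) (.inr p.2)) :
    LowerSemicontinuous fun p : (X ⊕ Y) × (X ⊕ Y) => g p.1 p.2 := by
  rintro ⟨u | u, v | v⟩ c hc <;>
    simp only [nhds_prod_eq, nhds_inl, nhds_inr, Filter.prod_map_map_eq, Filter.eventually_map]
  · simpa only [nhds_prod_eq] using hll (u, v) c hc
  · simpa only [nhds_prod_eq] using hlr (u, v) c hc
  · simpa only [nhds_prod_eq] using hrl (u, v) c hc
  · simpa only [nhds_prod_eq] using hrr (u, v) c hc

theorem stmt_6 {A X B : Type*}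
    [TopologicalSpace A] [CompactSpace A] [T2Space A]
    [TopologicalSpace X] [CompactSpace X] [T2Space X]
    [TopologicalSpace B] [CompactSpace B] [T2Space B]
    (dA : A → A → ℝ≥0∞) (dX : X → X → ℝ≥0∞) (dB : B → B → ℝ≥0∞)
    (hA : IsEMetric dA ∧ IsSepMetric dA ∧ LowerSemicontinuous (fun p : A × A => dA p.1 p.2))
    (hX : IsEMetric dX ∧ IsSepMetric dX ∧ LowerSemicontinuous (fun p : X × X => dX p.1 p.2))
    (hB : IsEMetric dB ∧ IsSepMetric dB ∧ LowerSemicontinuous (fun p : B × B => dB p.1 p.2))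
    -- `i` is an embedding
    (i : A → X) (hi : Continuous i) (hiinj : Function.Injective i)
    (hiiso : ∀ a a', dX (i a) (i a') = dA a a')
    -- `f` is a morphism
    (f : A → B) (hf : Continuous f) (hfne : ∀ a a', dB (f a) (f a') ≤ dA a a') :
    LowerSemicontinuous (fun p : (B ⊕ X) × (B ⊕ X) => gammaPush dX dB i f p.1 p.2) := by
  refine LowerSemicontinuous.of_sum_prod_sum hB.2.2 ?_ ?_ ?_
  · exact LowerSemicontinuous.iInf_of_compactSpace
      ((hB.2.2.comp (by fun_prop : Continuous fun q : (B × X) × A => (q.1.1, f q.2))).add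
        (hX.2.2.comp (by fun_prop : Continuous fun q : (B × X) × A => (i q.2, q.1.2))))
  · exact LowerSemicontinuous.iInf_of_compactSpace
      ((hX.2.2.comp (by fun_prop : Continuous fun q : (X × B) × A => (q.1.1, i q.2))).add
        (hB.2.2.comp (by fun_prop : Continuous fun q : (X × B) × A => (f q.2, q.1.2))))
  · refine hX.2.2.inf (LowerSemicontinuous.iInf_of_compactSpace
      (LowerSemicontinuous.iInf_of_compactSpace ?_))
    exact ((hX.2.2.comp (by fun_prop :
        Continuous fun q : ((X × X) × A) × A => (q.1.1.1, i q.1.2))).add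
      (hB.2.2.comp (by fun_prop :
        Continuous fun q : ((X × X) × A) × A => (f q.1.2, f q.2)))).add
      (hX.2.2.comp (by fun_prop :
        Continuous fun q : ((X × X) × A) × A => (i q.2, q.1.1.2)))
end

section
/- Let A, X, B be separated metric compact Hausdorff spaces, i : A → X an embedding and f : A → B a morphism, and let γ : (B ⊕ X) → (B ⊕ X) → [0,∞] be defined by: γ (inl b) (inl b') = d_B b b'; γ (inr x) (inr x') = min( d_X x x' , ⨅_{a, a' ∈ A} ( d_X x (i a) + d_B (f a) (f a') + d_X (i a') x' ) ); γ (inl b) (inr x) = ⨅_{a ∈ A} ( d_B b (f a) + d_X (i a) x ); γ (inr x) (inl b) = ⨅_{a ∈ A} ( d_X x (i a) + d_B (f a) b ). Then for every separated metric compact Hausdorff space Y and all morphisms g : X → Y and j : B → Y with j ∘ f = g ∘ i, the copairing h : B ⊕ X → Y (with h (inl b) = j b and h (inr x) = g x) satisfies d_Y (h w) (h z) ≤ γ w z for all w, z ∈ B ⊕ X. (This is the key step of the universal property of the pushout of an embedding along a morphism.) -/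
open ENNReal

theorem stmt_7 {A X B Y : Type*}
    [TopologicalSpace A] [CompactSpace A] [T2Space A]
    [TopologicalSpace X] [CompactSpace X] [T2Space X]
    [TopologicalSpace B] [CompactSpace B] [T2Space B]
    [TopologicalSpace Y] [CompactSpace Y] [T2Space Y]
    (dA : A → A → ℝ≥0∞) (dX : X → X → ℝ≥0∞) (dB : B → B → ℝ≥0∞) (dY : Y → Y → ℝ≥0∞)
    (hA : IsEMetric dA ∧ IsSepMetric dA ∧ LowerSemicontinuous (fun p : A × A => dA p.1 p.2))
    (hX : IsEMetric dX ∧ IsSepMetric dX ∧ LowerSemicontinuous (fun p : X × X => dX p.1 p.2))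
    (hB : IsEMetric dB ∧ IsSepMetric dB ∧ LowerSemicontinuous (fun p : B × B => dB p.1 p.2))
    (hY : IsEMetric dY ∧ IsSepMetric dY ∧ LowerSemicontinuous (fun p : Y × Y => dY p.1 p.2))
    -- `i` is an embedding
    (i : A → X) (hi : Continuous i) (hiinj : Function.Injective i)
    (hiiso : ∀ a a', dX (i a) (i a') = dA a a')
    -- `f` is a morphism
    (f : A → B) (hf : Continuous f) (hfne : ∀ a a', dB (f a) (f a') ≤ dA a a')
    -- `g` and `j` are morphisms with `j ∘ f = g ∘ i`
    (g : X → Y) (hg : Continuous g) (hgne : ∀ x x', dY (g x) (g x') ≤ dX x x')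
    (j : B → Y) (hj : Continuous j) (hjne : ∀ b b', dY (j b) (j b') ≤ dB b b')
    (hcomm : j ∘ f = g ∘ i) :
    ∀ w z : B ⊕ X, dY (Sum.elim j g w) (Sum.elim j g z) ≤ gammaPush dX dB i f w z := by
  have hc : ∀ a, j (f a) = g (i a) := congrFun hcomm
  have htri := hY.1.2
  rintro (b | x) (b' | x')
  · exact hjne b b'
  · refine le_iInf fun a => (htri _ (j (f a)) _).trans (add_le_add (hjne _ _) ?_)
    rw [hc]
    exact hgne _ _
  · refine le_iInf fun a => (htri _ (j (f a)) _).trans (add_le_add ?_ (hjne _ _))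
    rw [hc]
    exact hgne _ _
  · refine le_min (hgne x x') (le_iInf fun a => le_iInf fun a' => ?_)
    refine (htri _ (j (f a')) _).trans (add_le_add ?_ ?_)
    · refine (htri _ (j (f a)) _).trans (add_le_add ?_ (hjne _ _))
      rw [hc]
      exact hgne _ _
    · rw [hc]
      exact hgne _ _
end

section
/- Let f₀ : X → Y₀ and f₁ : X → Y₁ be embeddings of separated metric compact Hausdorff spaces. Define γ : (Y₀ ⊕ Y₁) → (Y₀ ⊕ Y₁) → [0,∞] by: γ (inl u) (inl u') = d_{Y₀} u u'; γ (inr v) (inr v') = d_{Y₁} v v'; γ (inl u) (inr v) = ⨅_{x ∈ X} ( d_{Y₀} u (f₀ x) + d_{Y₁} (f₁ x) v ); γ (inr v) (inl u) = ⨅_{x ∈ X} ( d_{Y₁} v (f₁ x) + d_{Y₀} (f₀ x) u ). Then γ is a metric on Y₀ ⊕ Y₁ (γ z z = 0 and the triangle inequality hold), γ is pointwise below the coproduct metric, and γ is lower semicontinuous on (Y₀ ⊕ Y₁) × (Y₀ ⊕ Y₁). (This γ describes the distance function of the pushout of the two embeddings.) -/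
open ENNReal

/-- The metric on `Y₀ ⊕ Y₁` describing the pushout of the embeddings
`f₀ : X → Y₀` and `f₁ : X → Y₁`. -/
noncomputable def gammaPO {X Y₀ Y₁ : Type*} (dY₀ : Y₀ → Y₀ → ℝ≥0∞) (dY₁ : Y₁ → Y₁ → ℝ≥0∞)
    (f₀ : X → Y₀) (f₁ : X → Y₁) : Y₀ ⊕ Y₁ → Y₀ ⊕ Y₁ → ℝ≥0∞
  | Sum.inl u, Sum.inl u' => dY₀ u u'
  | Sum.inr v, Sum.inr v' => dY₁ v v'
  | Sum.inl u, Sum.inr v => ⨅ x : X, (dY₀ u (f₀ x) + dY₁ (f₁ x) v)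
  | Sum.inr v, Sum.inl u => ⨅ x : X, (dY₁ v (f₁ x) + dY₀ (f₀ x) u)

lemma le_iInf_add_iInf_of_forall_le {ι : Type*} {a : ℝ≥0∞} {f g : ι → ℝ≥0∞}
    (h : ∀ i j, a ≤ f i + g j) : a ≤ (⨅ i, f i) + ⨅ j, g j := by
  rw [ENNReal.iInf_add]
  refine le_iInf fun i => ?_
  rw [ENNReal.add_iInf]
  exact le_iInf fun j => h i j

/-- The cross distance of two glued metrics is compatible with the triangle inequality on the
left. -/
lemma iInf_cross_le_left {X Y Z : Type*} {d : Y → Y → ℝ≥0∞} {e : Z → Z → ℝ≥0∞}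
    (hd : IsEMetric d) (f : X → Y) (g : X → Z) (u u' : Y) (v : Z) :
    (⨅ x, (d u (f x) + e (g x) v)) ≤ d u u' + ⨅ x, (d u' (f x) + e (g x) v) := by
  rw [ENNReal.add_iInf]
  refine iInf_mono fun x => ?_
  rw [← add_assoc]
  gcongr
  exact hd.2 _ _ _

/-- The cross distance of two glued metrics is compatible with the triangle inequality on the
right. -/
lemma iInf_cross_le_right {X Y Z : Type*} {d : Y → Y → ℝ≥0∞} {e : Z → Z → ℝ≥0∞}
    (he : IsEMetric e) (f : X → Y) (g : X → Z) (u : Y) (v v' : Z) :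
    (⨅ x, (d u (f x) + e (g x) v')) ≤ (⨅ x, (d u (f x) + e (g x) v)) + e v v' := by
  rw [ENNReal.iInf_add]
  refine iInf_mono fun x => ?_
  rw [add_assoc]
  gcongr
  exact he.2 _ _ _

/-- Passing to the other space and back does not shorten distances. -/
lemma le_iInf_cross_add_iInf_cross {X Y Z : Type*} {d : Y → Y → ℝ≥0∞} {e : Z → Z → ℝ≥0∞}
    (hd : IsEMetric d) (he : IsEMetric e) {f : X → Y} {g : X → Z}
    (hfg : ∀ x x', d (f x) (f x') = e (g x) (g x')) (u u' : Y) (v : Z) :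
    d u u' ≤ (⨅ x, (d u (f x) + e (g x) v)) + ⨅ x, (e v (g x) + d (f x) u') := by
  refine le_iInf_add_iInf_of_forall_le fun x x' => ?_
  calc d u u' ≤ d u (f x) + (d (f x) (f x') + d (f x') u') :=
        (hd.2 _ (f x) _).trans (by gcongr; exact hd.2 _ _ _)
    _ ≤ d u (f x) + ((e (g x) v + e v (g x')) + d (f x') u') := by
        rw [hfg]
        gcongr
        exact he.2 _ _ _
    _ = _ := by ring

lemma isEMetric_gammaPO {X Y₀ Y₁ : Type*} {dY₀ : Y₀ → Y₀ → ℝ≥0∞} {dY₁ : Y₁ → Y₁ → ℝ≥0∞}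
    (h₀ : IsEMetric dY₀) (h₁ : IsEMetric dY₁) {f₀ : X → Y₀} {f₁ : X → Y₁}
    (h : ∀ x x', dY₀ (f₀ x) (f₀ x') = dY₁ (f₁ x) (f₁ x')) :
    IsEMetric (gammaPO dY₀ dY₁ f₀ f₁) := by
  refine ⟨?_, ?_⟩
  · rintro (u | v)
    exacts [h₀.1 u, h₁.1 v]
  · rintro (a | a) (b | b) (c | c)
    · exact h₀.2 a b c
    · exact iInf_cross_le_left h₀ f₀ f₁ a b c
    · exact le_iInf_cross_add_iInf_cross h₀ h₁ h a c b
    · exact iInf_cross_le_right h₁ f₀ f₁ a b c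
    · exact iInf_cross_le_right h₀ f₁ f₀ a b c
    · exact le_iInf_cross_add_iInf_cross h₁ h₀ (fun x x' => (h x x').symm) a c b
    · exact iInf_cross_le_left h₁ f₁ f₀ a b c
    · exact h₁.2 a b c

lemma gammaPO_le_sumMetric {X Y₀ Y₁ : Type*} (dY₀ : Y₀ → Y₀ → ℝ≥0∞) (dY₁ : Y₁ → Y₁ → ℝ≥0∞)
    (f₀ : X → Y₀) (f₁ : X → Y₁) (w z : Y₀ ⊕ Y₁) :
    gammaPO dY₀ dY₁ f₀ f₁ w z ≤ sumMetric dY₀ dY₁ w z := by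
  rcases w with a | a <;> rcases z with b | b
  exacts [le_rfl, le_top, le_top, le_rfl]

/-- The infimum of a lower semicontinuous function over a compact space of parameters is lower
semicontinuous. -/
lemma LowerSemicontinuous.iInf_of_compactSpace_s8 {P X α : Type*} [TopologicalSpace P]
    [TopologicalSpace X] [CompactSpace X] [CompleteLinearOrder α] [DenselyOrdered α]
    {F : P × X → α} (hF : LowerSemicontinuous F) :
    LowerSemicontinuous fun p => ⨅ x, F (p, x) := by
  intro p c hc
  obtain ⟨c', hcc', hc'⟩ := exists_between hc
  have key : ∀ᶠ q in nhds p, ∀ x ∈ (Set.univ : Set X), c' < F (q, x) :=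
    isCompact_univ.eventually_forall_of_forall_eventually fun x _ =>
      hF (p, x) c' (hc'.trans_le (iInf_le _ x))
  filter_upwards [key] with q hq
  exact hcc'.trans_le (le_iInf fun x => (hq x trivial).le)

lemma lowerSemicontinuous_iInf_cross {X Y Z : Type*} [TopologicalSpace X] [CompactSpace X]
    [TopologicalSpace Y] [TopologicalSpace Z] {d : Y → Y → ℝ≥0∞} {e : Z → Z → ℝ≥0∞}
    (hd : LowerSemicontinuous fun p : Y × Y => d p.1 p.2)
    (he : LowerSemicontinuous fun p : Z × Z => e p.1 p.2)
    {f : X → Y} {g : X → Z} (hf : Continuous f) (hg : Continuous g) :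
    LowerSemicontinuous fun p : Y × Z => ⨅ x, (d p.1 (f x) + e (g x) p.2) := by
  refine LowerSemicontinuous.iInf_of_compactSpace_s8
    (F := fun q : (Y × Z) × X => d q.1.1 (f q.2) + e (g q.2) q.1.2) ?_
  have h₁ : Continuous fun q : (Y × Z) × X => (q.1.1, f q.2) := by fun_prop
  have h₂ : Continuous fun q : (Y × Z) × X => (g q.2, q.1.2) := by fun_prop
  exact (LowerSemicontinuous.comp hd h₁).add (LowerSemicontinuous.comp he h₂)

lemma lowerSemicontinuous_sum_prod_sum {A B C D α : Type*} [TopologicalSpace A]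
    [TopologicalSpace B] [TopologicalSpace C] [TopologicalSpace D] [Preorder α]
    {F : (A ⊕ B) × (C ⊕ D) → α}
    (hac : LowerSemicontinuous fun p : A × C => F (Sum.inl p.1, Sum.inl p.2))
    (had : LowerSemicontinuous fun p : A × D => F (Sum.inl p.1, Sum.inr p.2))
    (hbc : LowerSemicontinuous fun p : B × C => F (Sum.inr p.1, Sum.inl p.2))
    (hbd : LowerSemicontinuous fun p : B × D => F (Sum.inr p.1, Sum.inr p.2)) :
    LowerSemicontinuous F := by
  rintro ⟨a | a, b | b⟩ c hc <;>
    simp only [nhds_prod_eq, nhds_inl, nhds_inr, Filter.prod_map_map_eq, Filter.eventually_map] <;>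
    rw [← nhds_prod_eq]
  exacts [hac (a, b) c hc, had (a, b) c hc, hbc (a, b) c hc, hbd (a, b) c hc]

theorem stmt_8 {X Y₀ Y₁ : Type*}
    [TopologicalSpace X] [CompactSpace X] [T2Space X]
    [TopologicalSpace Y₀] [CompactSpace Y₀] [T2Space Y₀]
    [TopologicalSpace Y₁] [CompactSpace Y₁] [T2Space Y₁]
    (dX : X → X → ℝ≥0∞) (dY₀ : Y₀ → Y₀ → ℝ≥0∞) (dY₁ : Y₁ → Y₁ → ℝ≥0∞)
    (hX : IsEMetric dX ∧ IsSepMetric dX ∧ LowerSemicontinuous (fun p : X × X => dX p.1 p.2))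
    (hY₀ : IsEMetric dY₀ ∧ IsSepMetric dY₀ ∧
      LowerSemicontinuous (fun p : Y₀ × Y₀ => dY₀ p.1 p.2))
    (hY₁ : IsEMetric dY₁ ∧ IsSepMetric dY₁ ∧
      LowerSemicontinuous (fun p : Y₁ × Y₁ => dY₁ p.1 p.2))
    -- `f₀` and `f₁` are embeddings
    (f₀ : X → Y₀) (hf₀ : Continuous f₀) (hf₀inj : Function.Injective f₀)
    (hf₀iso : ∀ x x', dY₀ (f₀ x) (f₀ x') = dX x x')
    (f₁ : X → Y₁) (hf₁ : Continuous f₁) (hf₁inj : Function.Injective f₁)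
    (hf₁iso : ∀ x x', dY₁ (f₁ x) (f₁ x') = dX x x') :
    IsEMetric (gammaPO dY₀ dY₁ f₀ f₁) ∧
    (∀ w z, gammaPO dY₀ dY₁ f₀ f₁ w z ≤ sumMetric dY₀ dY₁ w z) ∧
    LowerSemicontinuous (fun p : (Y₀ ⊕ Y₁) × (Y₀ ⊕ Y₁) => gammaPO dY₀ dY₁ f₀ f₁ p.1 p.2) := by
  exact ⟨isEMetric_gammaPO hY₀.1 hY₁.1 fun x x' => (hf₀iso x x').trans (hf₁iso x x').symm,
    gammaPO_le_sumMetric dY₀ dY₁ f₀ f₁,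
    lowerSemicontinuous_sum_prod_sum hY₀.2.2
      (lowerSemicontinuous_iInf_cross hY₀.2.2 hY₁.2.2 hf₀ hf₁)
      (lowerSemicontinuous_iInf_cross hY₁.2.2 hY₀.2.2 hf₁ hf₀) hY₁.2.2⟩
end

section
/- Let f₀ : X → Y₀ and f₁ : X → Y₁ be embeddings of separated metric compact Hausdorff spaces, and let y₀ ∈ Y₀ and y₁ ∈ Y₁ be such that ⨅_{x ∈ X} ( d_{Y₀} y₀ (f₀ x) + d_{Y₁} (f₁ x) y₁ ) = 0 and ⨅_{x ∈ X} ( d_{Y₁} y₁ (f₁ x) + d_{Y₀} (f₀ x) y₀ ) = 0. Then there exists a unique x ∈ X with f₀ x = y₀ and f₁ x = y₁. (This expresses that the pushout square of two embeddings is also a pullback.) -/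
open ENNReal

/-- On a compact space, a lower semicontinuous function with infimum zero has a zero. -/
theorem exists_eq_zero_of_iInf_eq_zero {X : Type*} [TopologicalSpace X] [CompactSpace X]
    {g : X → ℝ≥0∞} (hg : LowerSemicontinuous g) (h : ⨅ x, g x = 0) : ∃ x, g x = 0 := by
  rcases isEmpty_or_nonempty X with hX | hX
  · exact absurd (iInf_of_empty g ▸ h) ENNReal.top_ne_zero
  · obtain ⟨x, -, hx⟩ :=
      (hg.lowerSemicontinuousOn Set.univ).exists_isMinOn Set.univ_nonempty isCompact_univ
    exact ⟨x, le_antisymm (h ▸ le_iInf fun y => hx (Set.mem_univ y)) zero_le⟩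

/-- A distance which factors through a point at distance zero from both ends vanishes. -/
theorem IsEMetric.eq_zero_trans {X : Type*} {d : X → X → ℝ≥0∞} (hd : IsEMetric d) {x y z : X}
    (hxy : d x y = 0) (hyz : d y z = 0) : d x z = 0 := by
  simpa [hxy, hyz] using hd.2 x y z

theorem stmt_9 {X Y₀ Y₁ : Type*}
    [TopologicalSpace X] [CompactSpace X] [T2Space X]
    [TopologicalSpace Y₀] [CompactSpace Y₀] [T2Space Y₀]
    [TopologicalSpace Y₁] [CompactSpace Y₁] [T2Space Y₁]
    (dX : X → X → ℝ≥0∞) (dY₀ : Y₀ → Y₀ → ℝ≥0∞) (dY₁ : Y₁ → Y₁ → ℝ≥0∞)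
    (hX : IsEMetric dX ∧ IsSepMetric dX ∧ LowerSemicontinuous (fun p : X × X => dX p.1 p.2))
    (hY₀ : IsEMetric dY₀ ∧ IsSepMetric dY₀ ∧
      LowerSemicontinuous (fun p : Y₀ × Y₀ => dY₀ p.1 p.2))
    (hY₁ : IsEMetric dY₁ ∧ IsSepMetric dY₁ ∧
      LowerSemicontinuous (fun p : Y₁ × Y₁ => dY₁ p.1 p.2))
    -- `f₀` and `f₁` are embeddings
    (f₀ : X → Y₀) (hf₀ : Continuous f₀) (hf₀inj : Function.Injective f₀)
    (hf₀iso : ∀ x x', dY₀ (f₀ x) (f₀ x') = dX x x')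
    (f₁ : X → Y₁) (hf₁ : Continuous f₁) (hf₁inj : Function.Injective f₁)
    (hf₁iso : ∀ x x', dY₁ (f₁ x) (f₁ x') = dX x x')
    (y₀ : Y₀) (y₁ : Y₁)
    (h₀ : ⨅ x : X, (dY₀ y₀ (f₀ x) + dY₁ (f₁ x) y₁) = 0)
    (h₁ : ⨅ x : X, (dY₁ y₁ (f₁ x) + dY₀ (f₀ x) y₀) = 0) :
    ∃! x : X, f₀ x = y₀ ∧ f₁ x = y₁ := by
  obtain ⟨-, hXsep, -⟩ := hX
  obtain ⟨hm₀, hsep₀, hlsc₀⟩ := hY₀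
  obtain ⟨hm₁, hsep₁, hlsc₁⟩ := hY₁
  obtain ⟨x, hx⟩ := exists_eq_zero_of_iInf_eq_zero
    ((hlsc₀.comp (by fun_prop : Continuous fun x => (y₀, f₀ x))).add
      (hlsc₁.comp (by fun_prop : Continuous fun x => (f₁ x, y₁)))) h₀
  obtain ⟨x', hx'⟩ := exists_eq_zero_of_iInf_eq_zero
    ((hlsc₁.comp (by fun_prop : Continuous fun x => (y₁, f₁ x))).add
      (hlsc₀.comp (by fun_prop : Continuous fun x => (f₀ x, y₀)))) h₁
  obtain ⟨hx₀, hx₁⟩ := add_eq_zero.mp hx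
  obtain ⟨hx'₁, hx'₀⟩ := add_eq_zero.mp hx'
  obtain rfl : x = x' := hXsep x x'
    (by rw [← hf₁iso]; exact hm₁.eq_zero_trans hx₁ hx'₁)
    (by rw [← hf₀iso]; exact hm₀.eq_zero_trans hx'₀ hx₀)
  have hy₀ : f₀ x = y₀ := hsep₀ _ _ hx'₀ hx₀
  exact ⟨x, ⟨hy₀, hsep₁ _ _ hx₁ hx'₁⟩, fun z hz => hf₀inj (hz.1.trans hy₀.symm)⟩
end

section
/- Let X be a compact Hausdorff topological space and ρ : X × X → [0,∞] (valued in ℝ≥0∞) a lower semicontinuous function such that for all x, y ∈ X, ρ (x, y) = ⨅_{z ∈ X} ( ρ (x, z) + ρ (z, y) ). Let A = { x ∈ X | ρ (x, x) = 0 }. Then for all x, y ∈ X, ρ (x, y) = ⨅_{a ∈ A} ( ρ (x, a) + ρ (a, y) ). -/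
open ENNReal

open Filter Topology

theorem LowerSemicontinuous.add_through {X : Type*} [TopologicalSpace X] {ρ : X × X → ℝ≥0∞}
    (hρ : LowerSemicontinuous ρ) (x y : X) :
    LowerSemicontinuous fun z => ρ (x, z) + ρ (z, y) :=
  (LowerSemicontinuous.comp hρ (Continuous.prodMk_right x)).add
    (LowerSemicontinuous.comp hρ (Continuous.prodMk_left y))

/-- On a compact space, the infimum in the idempotency relation is attained. -/
theorem exists_intermediate_of_idempotent {X : Type*} [TopologicalSpace X] [CompactSpace X]
    (ρ : X × X → ℝ≥0∞) (hρ : LowerSemicontinuous ρ)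
    (hidem : ∀ x y : X, ρ (x, y) = ⨅ z : X, (ρ (x, z) + ρ (z, y))) (x y : X) :
    ∃ z, ρ (x, y) = ρ (x, z) + ρ (z, y) := by
  obtain ⟨z, -, hz⟩ := ((hρ.add_through x y).lowerSemicontinuousOn Set.univ).exists_isMinOn
    ⟨x, Set.mem_univ x⟩ isCompact_univ
  refine ⟨z, (hidem x y).trans (le_antisymm (iInf_le _ z) (le_iInf fun w => ?_))⟩
  exact hz (Set.mem_univ w)

/-- Iterating a choice of intermediate points between `x` and the current point stays on
geodesics starting at `x`. -/
theorem add_iterate_le_of_intermediate {X : Type*} (ρ : X × X → ℝ≥0∞)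
    (htri : ∀ x y z : X, ρ (x, y) ≤ ρ (x, z) + ρ (z, y)) (x : X) (f : X → X)
    (hf : ∀ w, ρ (x, w) = ρ (x, f w) + ρ (f w, w)) (n : ℕ) (w : X) :
    ρ (x, f^[n + 1] w) + ρ (f^[n + 1] w, w) ≤ ρ (x, w) := by
  induction n with
  | zero => exact (hf w).ge
  | succ n ih =>
    rw [Function.iterate_succ_apply' f (n + 1)]
    refine le_trans ?_ ih
    set v := f^[n + 1] w
    calc ρ (x, f v) + ρ (f v, w) ≤ ρ (x, f v) + (ρ (f v, v) + ρ (v, w)) := by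
          gcongr; exact htri _ _ _
      _ = ρ (x, v) + ρ (v, w) := by rw [← add_assoc, ← hf]

theorem stmt_11 {X : Type*} [TopologicalSpace X] [CompactSpace X] [T2Space X]
    (ρ : X × X → ℝ≥0∞) (hρ : LowerSemicontinuous ρ)
    (hidem : ∀ x y : X, ρ (x, y) = ⨅ z : X, (ρ (x, z) + ρ (z, y))) :
    ∀ x y : X, ρ (x, y) = ⨅ a : {a : X // ρ (a, a) = 0}, (ρ (x, a.1) + ρ (a.1, y)) := by
  intro x y
  have htri : ∀ x y z : X, ρ (x, y) ≤ ρ (x, z) + ρ (z, y) := fun x y z =>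
    (hidem x y).trans_le (iInf_le _ z)
  refine le_antisymm (le_iInf fun a => htri _ _ _) ?_
  rcases eq_or_ne (ρ (x, y)) ∞ with htop | hfin
  · rw [htop]; exact le_top
  choose f hf using fun w => exists_intermediate_of_idempotent ρ hρ hidem x w
  have key := add_iterate_le_of_intermediate ρ htri x f hf
  set z : ℕ → X := fun n => f^[n] y with hz
  have hzz : ∀ {n m}, n < m → ρ (x, z m) + ρ (z m, z n) ≤ ρ (x, z n) := by
    intro n m hnm
    obtain ⟨k, rfl⟩ := Nat.exists_eq_add_of_lt hnm
    have h := key k (z n)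
    rwa [hz, ← Function.iterate_add_apply, show k + 1 + n = n + k + 1 by ring] at h
  have hanti : Antitone fun n => ρ (x, z n) :=
    antitone_nat_of_succ_le fun n => le_self_add.trans (hzz n.lt_succ_self)
  have hL : ⨅ n, ρ (x, z n) ≠ ∞ := ne_top_of_le_ne_top hfin (iInf_le _ 0)
  let U : Ultrafilter ℕ := hyperfilter ℕ
  have hU : (U : Filter ℕ) ≤ atTop := Nat.hyperfilter_le_atTop
  obtain ⟨a, -, ha⟩ := isCompact_univ.ultrafilter_le_nhds (U.map z) (by simp)
  replace ha : Tendsto z U (𝓝 a) := ha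
  have haa : ρ (a, a) = 0 := by
    by_contra hne
    obtain ⟨c, hc0, hc⟩ := exists_between (pos_iff_ne_zero.2 hne)
    have hnear : ∀ᶠ p in 𝓝 a ×ˢ 𝓝 a, c < ρ p := by
      rw [← nhds_prod_eq]; exact hρ (a, a) c hc
    obtain ⟨s, hs, hsc⟩ := eventually_prod_self_iff'.1 hnear
    have hlt : ∀ᶠ n in (U : Filter ℕ), ρ (x, z n) < (⨅ n, ρ (x, z n)) + c :=
      hU ((tendsto_atTop_iInf hanti).eventually_lt_const (ENNReal.lt_add_right hL hc0.ne'))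
    have hmem := ha.eventually hs
    obtain ⟨n, hn, hns⟩ := (hlt.and hmem).exists
    obtain ⟨m, hm, hms⟩ := (((eventually_gt_atTop n).filter_mono hU).and hmem).exists
    have hmfin : ρ (x, z m) ≠ ∞ := ne_top_of_le_ne_top hfin (hanti (Nat.zero_le m))
    refine absurd (hsc _ hms _ hns) (not_lt.2 ?_)
    refine (ENNReal.add_le_add_iff_left hmfin).1 ((hzz hm).trans (hn.le.trans ?_))
    gcongr
    exact iInf_le _ m
  refine (iInf_le _ ⟨a, haa⟩).trans ?_
  refine le_of_forall_lt fun c hc => ?_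
  obtain ⟨n, hn, hn0⟩ := ((ha.eventually (hρ.add_through x y a c hc)).and ((eventually_gt_atTop 0).filter_mono hU)).exists
  exact hn.trans_le (hzz hn0)
end

section
/- Let X be a compact Hausdorff topological space and r a closed subset of X × X that is idempotent with respect to relational composition, i.e., for all x, y ∈ X, (x, y) ∈ r if and only if there exists z ∈ X with (x, z) ∈ r and (z, y) ∈ r. Then for every (x, y) ∈ r there exists a ∈ X such that (x, a) ∈ r, (a, a) ∈ r, and (a, y) ∈ r. -/
theorem stmt_12 {X : Type*} [TopologicalSpace X] [CompactSpace X] [T2Space X]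
    (r : Set (X × X)) (hr : IsClosed r)
    (hidem : ∀ x y : X, (x, y) ∈ r ↔ ∃ z : X, (x, z) ∈ r ∧ (z, y) ∈ r) :
    ∀ x y : X, (x, y) ∈ r → ∃ a : X, (x, a) ∈ r ∧ (a, a) ∈ r ∧ (a, y) ∈ r := by
  intro x y hxy
  have interp : ∀ z : {z : X // (z, y) ∈ r}, ∃ w : {z : X // (z, y) ∈ r}, (z.1, w.1) ∈ r := by
    rintro ⟨z, hz⟩
    obtain ⟨w, hzw, hwy⟩ := (hidem z y).1 hz
    exact ⟨⟨w, hwy⟩, hzw⟩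
  choose f hf using interp
  let c : ℕ → {z : X // (z, y) ∈ r} := fun n => f^[n] ⟨x, hxy⟩
  have hsucc : ∀ n, ((c n).1, (c (n + 1)).1) ∈ r := fun n => by
    simpa only [c, Function.iterate_succ_apply'] using hf (c n)
  have hlt : ∀ m n, m < n → ((c m).1, (c n).1) ∈ r := fun m n hmn => by
    induction n, hmn using Nat.le_induction with
    | base => exact hsucc m
    | succ n _ ih => exact (hidem _ _).2 ⟨_, ih, hsucc n⟩
  -- Pass to the limit of the chain along an ultrafilter finer than `atTop`.
  let U : Ultrafilter ℕ := Ultrafilter.of Filter.atTop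
  have hU : (U : Filter ℕ) ≤ Filter.atTop := Ultrafilter.of_le _
  obtain ⟨a, -, ha⟩ := isCompact_univ.ultrafilter_le_nhds (U.map fun n => (c n).1) (by simp)
  have hlim : Filter.Tendsto (fun n => (c n).1) U (nhds a) := ha
  have hca : ∀ m, ((c m).1, a) ∈ r := fun m =>
    hr.mem_of_tendsto (tendsto_const_nhds.prodMk_nhds hlim)
      (hU ((Filter.eventually_gt_atTop m).mono fun n hn => hlt m n hn))
  exact ⟨a, hca 0,
    hr.mem_of_tendsto (hlim.prodMk_nhds tendsto_const_nhds) (Filter.Eventually.of_forall hca),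
    hr.mem_of_tendsto (hlim.prodMk_nhds tendsto_const_nhds)
      (Filter.Eventually.of_forall fun n => (c n).2)⟩
end

section
/- Let (X, d) be a separated metric compact Hausdorff space and let γ be a metric on X ⊕ X that is lower semicontinuous on (X ⊕ X) × (X ⊕ X), pointwise below the coproduct metric, and satisfies for all x, y ∈ X: (reflexivity) d x y ≤ γ u v whenever u ∈ {inl x, inr x} and v ∈ {inl y, inr y}; (symmetry) γ (inl x) (inr y) = γ (inr x) (inl y) and γ (inl x) (inl y) = γ (inr x) (inr y); (transitivity) γ (inl x) (inr y) = ⨅_{z ∈ X} ( γ (inl x) (inr z) + γ (inl z) (inr y) ) and γ (inr x) (inl y) = ⨅_{z ∈ X} ( γ (inr x) (inl z) + γ (inr z) (inl y) ). Define ρ x y = γ (inl x) (inr y) and A = { a ∈ X | ρ a a = 0 }. Then for all x, y ∈ X, ρ x y = ⨅_{a ∈ A} ( d x a + d a y ). (This is the key computation showing that every equivalence corelation in the category of separated metric compact Hausdorff spaces is effective.) -/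
open ENNReal

/-- A nonempty compact space carries a minimizer of a lower semicontinuous function, so an
interpolation formula given by an infimum is attained. -/
theorem exists_le_of_eq_iInf_add {X : Type*} [TopologicalSpace X] [CompactSpace X]
    {ρ : X → X → ℝ≥0∞} (hρ : LowerSemicontinuous (fun p : X × X => ρ p.1 p.2))
    (htrans : ∀ x y, ρ x y = ⨅ z, (ρ x z + ρ z y)) (x y : X) :
    ∃ z, ρ x z + ρ z y ≤ ρ x y := by
  have h₁ : LowerSemicontinuous (fun z => ρ x z) :=
    hρ.comp (by fun_prop : Continuous fun z : X => (x, z))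
  have h₂ : LowerSemicontinuous (fun z => ρ z y) :=
    hρ.comp (by fun_prop : Continuous fun z : X => (z, y))
  obtain ⟨z, -, hz⟩ := ((h₁.add h₂).lowerSemicontinuousOn Set.univ).exists_isMinOn
    ⟨x, Set.mem_univ x⟩ isCompact_univ
  refine ⟨z, ?_⟩
  rw [htrans x y]
  exact le_iInf fun w => hz (Set.mem_univ w)

/-- An interpolative lower semicontinuous `ρ ≥ d` with `ρ x y < ∞` vanishes at some pair `(u, v)`
such that passing through `u` and `v` costs at most `ρ x y`. -/
theorem exists_eq_zero_add_le {X : Type*} [TopologicalSpace X] [CompactSpace X]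
    {d ρ : X → X → ℝ≥0∞} (hmet : IsEMetric d)
    (hd : LowerSemicontinuous (fun p : X × X => d p.1 p.2))
    (hρ : LowerSemicontinuous (fun p : X × X => ρ p.1 p.2)) (hle : ∀ x y, d x y ≤ ρ x y)
    (hint : ∀ x y, ∃ z, ρ x z + ρ z y ≤ ρ x y) {x y : X} (hxy : ρ x y ≠ ∞) :
    ∃ u v, ρ u v = 0 ∧ d x u + d v y ≤ ρ x y := by
  have h₁ : LowerSemicontinuous (fun p : X × X => d x p.1) :=
    hd.comp (by fun_prop : Continuous fun p : X × X => (x, p.1))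
  have h₂ : LowerSemicontinuous (fun p : X × X => d p.2 y) :=
    hd.comp (by fun_prop : Continuous fun p : X × X => (p.2, y))
  have hclosed : IsClosed {p : X × X | d x p.1 + ρ p.1 p.2 + d p.2 y ≤ ρ x y} :=
    ((h₁.add hρ).add h₂).isClosed_preimage (ρ x y)
  obtain ⟨⟨u, v⟩, huv, hmin⟩ := (hρ.lowerSemicontinuousOn _).exists_isMinOn
    (⟨(x, y), by simp [hmet.1]⟩ : Set.Nonempty {p : X × X | d x p.1 + ρ p.1 p.2 + d p.2 y ≤ ρ x y})
    hclosed.isCompact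
  simp only [Set.mem_ofPred_eq] at huv
  have hfin : ρ u v ≠ ∞ :=
    ne_top_of_le_ne_top hxy ((le_add_self.trans le_self_add).trans huv)
  obtain ⟨z, hz⟩ := hint u v
  have hleft : ρ u v ≤ ρ u z := by
    refine hmin (a := (u, z)) ?_
    calc d x u + ρ u z + d z y ≤ d x u + ρ u z + (ρ z v + d v y) := by
          gcongr
          exact (hmet.2 z v y).trans (by gcongr; exact hle z v)
      _ = d x u + (ρ u z + ρ z v) + d v y := by ring
      _ ≤ d x u + ρ u v + d v y := by gcongr
      _ ≤ ρ x y := huv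
  have hright : ρ u v ≤ ρ z v := by
    refine hmin (a := (z, v)) ?_
    calc d x z + ρ z v + d v y ≤ (d x u + ρ u z) + ρ z v + d v y := by
          gcongr
          exact (hmet.2 x u z).trans (by gcongr; exact hle u z)
      _ = d x u + (ρ u z + ρ z v) + d v y := by ring
      _ ≤ d x u + ρ u v + d v y := by gcongr
      _ ≤ ρ x y := huv
  have hzero : ρ u v = 0 := by
    have h : ρ u v + ρ u v ≤ ρ u v + 0 := by
      simpa using (add_le_add hleft hright).trans hz
    exact le_zero_iff.mp ((ENNReal.add_le_add_iff_left hfin).mp h)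
  exact ⟨u, v, hzero, by simpa [hzero] using huv⟩

/-- The zero set of a lower semicontinuous function is closed under limits. -/
theorem LowerSemicontinuous.eq_zero_of_tendsto {ι Y : Type*} [TopologicalSpace Y]
    {f : Y → ℝ≥0∞} (hf : LowerSemicontinuous f) {l : Filter ι} [l.NeBot] {s : ι → Y} {y : Y}
    (hs : Filter.Tendsto s l (nhds y)) (h : ∀ᶠ i in l, f (s i) = 0) : f y = 0 := by
  have hclosed : IsClosed {z | f z ≤ 0} := hf.isClosed_preimage 0
  exact le_zero_iff.mp (hclosed.mem_of_tendsto hs (h.mono fun i hi => hi.le))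

/-- In a separated metric compact Hausdorff space, between two points related by the zero relation
of an interpolative `ρ ≥ d` there is a point related to itself. -/
theorem exists_self_eq_zero_between {X : Type*} [TopologicalSpace X] [CompactSpace X]
    {d ρ : X → X → ℝ≥0∞} (hmet : IsEMetric d) (hsep : IsSepMetric d)
    (hd : LowerSemicontinuous (fun p : X × X => d p.1 p.2))
    (hρ : LowerSemicontinuous (fun p : X × X => ρ p.1 p.2)) (hle : ∀ x y, d x y ≤ ρ x y)
    (hint : ∀ x y, ∃ z, ρ x z + ρ z y ≤ ρ x y) {u v : X} (huv : ρ u v = 0) :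
    ∃ a, ρ a a = 0 ∧ d u a = 0 ∧ d a v = 0 := by
  have hstep : ∀ z : {z // ρ z v = 0}, ∃ w : {w // ρ w v = 0}, ρ z.1 w.1 = 0 := by
    rintro ⟨z, hz⟩
    obtain ⟨w, hw⟩ := hint z v
    rw [hz, le_zero_iff, add_eq_zero] at hw
    exact ⟨⟨w, hw.2⟩, hw.1⟩
  choose next hnext using hstep
  let s : ℕ → X := fun n => (next^[n] ⟨u, huv⟩).1
  have hsv (n : ℕ) : ρ (s n) v = 0 := (next^[n] ⟨u, huv⟩).2
  have hss (n : ℕ) : ρ (s n) (s (n + 1)) = 0 := by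
    simp only [s, Function.iterate_succ_apply']
    exact hnext _
  have hmono {m n : ℕ} (hmn : m ≤ n) : d (s m) (s n) = 0 := by
    induction n, hmn using Nat.le_induction with
    | base => exact hmet.1 _
    | succ n _ ih =>
      refine le_zero_iff.mp ((hmet.2 _ (s n) _).trans ?_)
      rw [ih, zero_add]
      exact (hle _ _).trans (hss n).le
  let U : Ultrafilter ℕ := Filter.hyperfilter ℕ
  have hU : (U : Filter ℕ) ≤ Filter.atTop := Nat.hyperfilter_le_atTop
  obtain ⟨a, -, ha⟩ := isCompact_univ.ultrafilter_le_nhds (U.map s) (by simp)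
  obtain ⟨b, -, hb⟩ := isCompact_univ.ultrafilter_le_nhds (U.map fun n => s (n + 1)) (by simp)
  replace ha : Filter.Tendsto s U (nhds a) := ha
  replace hb : Filter.Tendsto (fun n => s (n + 1)) U (nhds b) := hb
  have hsa (n : ℕ) : d (s n) a = 0 :=
    hd.eq_zero_of_tendsto (tendsto_const_nhds.prodMk_nhds ha)
      (hU ((Filter.eventually_ge_atTop n).mono fun m hm => hmono hm))
  have hsb (n : ℕ) : d (s n) b = 0 :=
    hd.eq_zero_of_tendsto (tendsto_const_nhds.prodMk_nhds hb)
      (hU ((Filter.eventually_ge_atTop n).mono fun m hm => hmono (hm.trans m.le_succ)))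
  have hab : a = b := hsep a b
    (hd.eq_zero_of_tendsto (ha.prodMk_nhds tendsto_const_nhds) (.of_forall hsb))
    (hd.eq_zero_of_tendsto (hb.prodMk_nhds tendsto_const_nhds) (.of_forall fun n => hsa (n + 1)))
  subst hab
  exact ⟨a, hρ.eq_zero_of_tendsto (ha.prodMk_nhds hb) (.of_forall hss), hsa 0,
    hd.eq_zero_of_tendsto (ha.prodMk_nhds tendsto_const_nhds)
      (.of_forall fun n => le_zero_iff.mp ((hle _ _).trans (hsv n).le))⟩

theorem stmt_13 {X : Type*} [TopologicalSpace X] [CompactSpace X] [T2Space X]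
    (d : X → X → ℝ≥0∞) (hmet : IsEMetric d) (hsep : IsSepMetric d)
    (hlsc : LowerSemicontinuous (fun p : X × X => d p.1 p.2))
    (γ : X ⊕ X → X ⊕ X → ℝ≥0∞) (hγmet : IsEMetric γ)
    (hγlsc : LowerSemicontinuous (fun p : (X ⊕ X) × (X ⊕ X) => γ p.1 p.2))
    (hγle : ∀ w z, γ w z ≤ sumMetric d d w z)
    -- reflexivity
    (hrefl : ∀ (x y : X) (u v : X ⊕ X),
      (u = Sum.inl x ∨ u = Sum.inr x) → (v = Sum.inl y ∨ v = Sum.inr y) → d x y ≤ γ u v)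
    -- symmetry
    (hsymm₁ : ∀ x y : X, γ (Sum.inl x) (Sum.inr y) = γ (Sum.inr x) (Sum.inl y))
    (hsymm₂ : ∀ x y : X, γ (Sum.inl x) (Sum.inl y) = γ (Sum.inr x) (Sum.inr y))
    -- transitivity
    (htrans₁ : ∀ x y : X, γ (Sum.inl x) (Sum.inr y) =
      ⨅ z : X, (γ (Sum.inl x) (Sum.inr z) + γ (Sum.inl z) (Sum.inr y)))
    (htrans₂ : ∀ x y : X, γ (Sum.inr x) (Sum.inl y) =
      ⨅ z : X, (γ (Sum.inr x) (Sum.inl z) + γ (Sum.inr z) (Sum.inl y))) :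
    ∀ x y : X, γ (Sum.inl x) (Sum.inr y) =
      ⨅ a : {a : X // γ (Sum.inl a) (Sum.inr a) = 0}, (d x a.1 + d a.1 y) := by
  have hle : ∀ x y, d x y ≤ γ (Sum.inl x) (Sum.inr y) := fun x y =>
    hrefl x y _ _ (.inl rfl) (.inr rfl)
  have hρ : LowerSemicontinuous (fun p : X × X => γ (Sum.inl p.1) (Sum.inr p.2)) :=
    hγlsc.comp (by fun_prop :
      Continuous fun p : X × X => ((Sum.inl p.1, Sum.inr p.2) : (X ⊕ X) × (X ⊕ X)))
  have hint := exists_le_of_eq_iInf_add (ρ := fun x y => γ (Sum.inl x) (Sum.inr y)) hρ htrans₁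
  intro x y
  apply le_antisymm
  · refine le_iInf fun ⟨a, ha⟩ => ?_
    calc γ (Sum.inl x) (Sum.inr y)
        ≤ γ (Sum.inl x) (Sum.inl a) + (γ (Sum.inl a) (Sum.inr a) + γ (Sum.inr a) (Sum.inr y)) :=
          (hγmet.2 _ (Sum.inl a) _).trans (by gcongr; exact hγmet.2 _ _ _)
      _ = γ (Sum.inl x) (Sum.inl a) + γ (Sum.inr a) (Sum.inr y) := by rw [ha, zero_add]
      _ ≤ d x a + d a y := add_le_add (hγle _ _) (hγle _ _)
  · by_cases hxy : γ (Sum.inl x) (Sum.inr y) = ∞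
    · simp [hxy]
    obtain ⟨u, v, huv, hsum⟩ := exists_eq_zero_add_le hmet hlsc hρ hle hint hxy
    obtain ⟨a, ha, hua, hav⟩ := exists_self_eq_zero_between hmet hsep hlsc hρ hle hint huv
    refine (iInf_le _ ⟨a, ha⟩).trans (le_trans ?_ hsum)
    refine add_le_add ((hmet.2 x u a).trans ?_) ((hmet.2 a v y).trans ?_)
    · rw [hua, add_zero]
    · rw [hav, zero_add]
end

section
/- Let X and S be separated metric compact Hausdorff spaces and q : X ⊕ X → S a surjective morphism, where X ⊕ X carries the sum topology and the coproduct metric. Then there exists a morphism e : S → X with e (q (inl x)) = x and e (q (inr x)) = x for all x ∈ X if and only if for all x, y ∈ X, d_X x y ≤ d_S (q u) (q v) whenever u ∈ {inl x, inr x} and v ∈ {inl y, inr y}. (This characterises the reflexive binary corelations on X.) -/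
open ENNReal

theorem stmt_15 {X S : Type*}
    [TopologicalSpace X] [CompactSpace X] [T2Space X]
    [TopologicalSpace S] [CompactSpace S] [T2Space S]
    (d : X → X → ℝ≥0∞) (dS : S → S → ℝ≥0∞)
    (hX : IsEMetric d ∧ IsSepMetric d ∧ LowerSemicontinuous (fun p : X × X => d p.1 p.2))
    (hS : IsEMetric dS ∧ IsSepMetric dS ∧ LowerSemicontinuous (fun p : S × S => dS p.1 p.2))
    -- `q` is a surjective morphism from `X ⊕ X` (with the coproduct metric) to `S`
    (q : X ⊕ X → S) (hq : Continuous q)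
    (hqne : ∀ w z : X ⊕ X, dS (q w) (q z) ≤ sumMetric d d w z)
    (hqsurj : Function.Surjective q) :
    (∃ e : S → X, Continuous e ∧ (∀ s s', d (e s) (e s') ≤ dS s s') ∧
        (∀ x : X, e (q (Sum.inl x)) = x) ∧ (∀ x : X, e (q (Sum.inr x)) = x)) ↔
      ∀ (x y : X) (u v : X ⊕ X),
        (u = Sum.inl x ∨ u = Sum.inr x) → (v = Sum.inl y ∨ v = Sum.inr y) →
        d x y ≤ dS (q u) (q v) := by
  obtain ⟨_, hsep, _⟩ := hX
  obtain ⟨⟨hS0, _⟩, _, _⟩ := hS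
  constructor
  · rintro ⟨e, -, hne, hl, hr⟩ x y u v hu hv
    have hu' : e (q u) = x := by rcases hu with rfl | rfl <;> simp [hl, hr]
    have hv' : e (q v) = y := by rcases hv with rfl | rfl <;> simp [hl, hr]
    simpa only [hu', hv'] using hne (q u) (q v)
  · intro h
    let fold : X ⊕ X → X := Sum.elim id id
    have hfold : ∀ u : X ⊕ X, u = Sum.inl (fold u) ∨ u = Sum.inr (fold u) := by
      rintro (x | x) <;> simp [fold]
    have hle : ∀ u v, d (fold u) (fold v) ≤ dS (q u) (q v) := fun u v =>
      h _ _ u v (hfold u) (hfold v)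
    have hfactor : ∀ u v, q u = q v → fold u = fold v := fun u v huv =>
      hsep _ _ (le_zero_iff.mp ((hle u v).trans_eq (by rw [huv, hS0])))
        (le_zero_iff.mp ((hle v u).trans_eq (by rw [huv, hS0])))
    let e : S → X := fold ∘ Function.surjInv hqsurj
    have he : ∀ u, e (q u) = fold u := fun u =>
      hfactor _ _ (Function.surjInv_eq hqsurj (q u))
    refine ⟨e, ?_, fun s s' => ?_, fun x => he (Sum.inl x), fun x => he (Sum.inr x)⟩
    · rw [(hq.isClosedMap.isQuotientMap hq hqsurj).continuous_iff, show e ∘ q = fold from funext he]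
      exact continuous_id.sumElim continuous_id
    · simpa only [e, Function.comp_apply, Function.surjInv_eq] using
        hle (Function.surjInv hqsurj s) (Function.surjInv hqsurj s')
end

section
/- Let X and S be separated metric compact Hausdorff spaces and q : X ⊕ X → S a surjective morphism, where X ⊕ X carries the sum topology and the coproduct metric, and let swap : X ⊕ X → X ⊕ X be the map exchanging the two summands (swap (inl x) = inr x, swap (inr x) = inl x). Then there exists a morphism s : S → S with s ∘ q = q ∘ swap if and only if for all u, v ∈ X ⊕ X, d_S (q u) (q v) = d_S (q (swap u)) (q (swap v)). (This characterises the symmetric binary corelations on X.) -/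
open ENNReal

theorem stmt_16 {X S : Type*}
    [TopologicalSpace X] [CompactSpace X] [T2Space X]
    [TopologicalSpace S] [CompactSpace S] [T2Space S]
    (d : X → X → ℝ≥0∞) (dS : S → S → ℝ≥0∞)
    (hX : IsEMetric d ∧ IsSepMetric d ∧ LowerSemicontinuous (fun p : X × X => d p.1 p.2))
    (hS : IsEMetric dS ∧ IsSepMetric dS ∧ LowerSemicontinuous (fun p : S × S => dS p.1 p.2))
    -- `q` is a surjective morphism from `X ⊕ X` (with the coproduct metric) to `S`
    (q : X ⊕ X → S) (hq : Continuous q)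
    (hqne : ∀ w z : X ⊕ X, dS (q w) (q z) ≤ sumMetric d d w z)
    (hqsurj : Function.Surjective q) :
    (∃ s : S → S, Continuous s ∧ (∀ a b : S, dS (s a) (s b) ≤ dS a b) ∧
        s ∘ q = q ∘ Sum.swap) ↔
      ∀ u v : X ⊕ X, dS (q u) (q v) = dS (q (Sum.swap u)) (q (Sum.swap v)) := by
  constructor
  · rintro ⟨s, -, hs, hsq⟩ u v
    have h (w z : X ⊕ X) : dS (q w.swap) (q z.swap) ≤ dS (q w) (q z) := by
      have hw (w : X ⊕ X) : s (q w) = q w.swap := congrFun hsq w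
      simpa only [hw] using hs (q w) (q z)
    exact le_antisymm (by simpa using h u.swap v.swap) (h u v)
  · intro h
    obtain ⟨⟨hrefl, -⟩, hsep, -⟩ := hS
    have hker (u v : X ⊕ X) (huv : q u = q v) : q u.swap = q v.swap :=
      hsep _ _ (by rw [← h, huv, hrefl]) (by rw [← h, huv, hrefl])
    have hsq : (q ∘ Sum.swap ∘ Function.surjInv hqsurj) ∘ q = q ∘ Sum.swap :=
      funext fun u => hker _ _ (Function.surjInv_eq hqsurj (q u))
    refine ⟨q ∘ Sum.swap ∘ Function.surjInv hqsurj, ?_, fun a b => ?_, hsq⟩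
    · rw [(hq.isClosedMap.isQuotientMap hq hqsurj).continuous_iff, hsq]
      exact hq.comp continuous_sum_swap
    · simp only [Function.comp_apply, ← h, Function.surjInv_eq, le_refl]
end

section
/- Let (X_i, d_i)_{i ∈ I} be a family of separated metric compact Hausdorff spaces. Then the product ∏_{i ∈ I} X_i, equipped with the product topology and the sup-metric d x y = ⨆_{i ∈ I} d_i (x i) (y i), is a separated metric compact Hausdorff space: the product topology is compact Hausdorff, d is a separated metric, d is lower semicontinuous on the product of the product with itself, and every projection is a continuous non-expansive map. -/
open ENNReal

theorem stmt_18 {I : Type*} {X : I → Type*}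
    [∀ i, TopologicalSpace (X i)] [∀ i, CompactSpace (X i)] [∀ i, T2Space (X i)]
    (d : ∀ i, X i → X i → ℝ≥0∞)
    (hmet : ∀ i, IsEMetric (d i)) (hsep : ∀ i, IsSepMetric (d i))
    (hlsc : ∀ i, LowerSemicontinuous (fun p : X i × X i => d i p.1 p.2)) :
    -- the product topology is compact Hausdorff
    CompactSpace (∀ i, X i) ∧ T2Space (∀ i, X i) ∧
    -- the sup-metric is a separated metric
    IsEMetric (fun x y : ∀ i, X i => ⨆ i, d i (x i) (y i)) ∧
    IsSepMetric (fun x y : ∀ i, X i => ⨆ i, d i (x i) (y i)) ∧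
    -- the sup-metric is lower semicontinuous on the product of the product with itself
    LowerSemicontinuous
      (fun p : (∀ i, X i) × (∀ i, X i) => ⨆ i, d i (p.1 i) (p.2 i)) ∧
    -- every projection is continuous and non-expansive
    ∀ i, Continuous (fun x : ∀ j, X j => x i) ∧
      ∀ x y : ∀ j, X j, d i (x i) (y i) ≤ ⨆ j, d j (x j) (y j) := by
  refine ⟨inferInstance, inferInstance, ⟨fun x => ?_, fun x y z => ?_⟩, fun x y hxy hyx => ?_,
    ?_, fun i => ⟨continuous_apply i, fun x y => le_iSup (fun j => d j (x j) (y j)) i⟩⟩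
  · simp [(hmet _).1]
  · exact iSup_le fun i => ((hmet i).2 (x i) (y i) (z i)).trans <|
      add_le_add (le_iSup (fun j => d j (x j) (y j)) i) (le_iSup (fun j => d j (y j) (z j)) i)
  · exact funext fun i =>
      hsep i _ _ (ENNReal.iSup_eq_zero.1 hxy i) (ENNReal.iSup_eq_zero.1 hyx i)
  · exact lowerSemicontinuous_iSup fun i =>
      (hlsc i).comp (g := fun p : (∀ j, X j) × (∀ j, X j) => (p.1 i, p.2 i)) (by fun_prop)
end
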